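/- arXiv:1909.12398 — 11 statements merged into one kernel-verified Lean document; each statement's English description precedes it below -/
import Mathlib

section
/- (Lemma 1, structure of the projection / relu form.) For every γ ∈ ℝ^{n+1} there exists a threshold ō ≥ 0 such that the Euclidean projection x = Π_C(γ) satisfies x₁ = ō and xᵢ = min(ō, γᵢ) for every i = 2, …, n+1. -/
/-- If two points agree off the coordinate `i`, their distances to a third point compare as their
`i`-th coordinates do. -/
theorem EuclideanSpace.abs_apply_sub_le_of_norm_sub_le {ι : Type*} [Fintype ι]
    {x y z : EuclideanSpace ℝ ι} {i : ι} (hxy : ∀ j, j ≠ i → y j = x j)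
    (h : ‖x - z‖ ≤ ‖y - z‖) : |x i - z i| ≤ |y i - z i| := by
  classical
  rw [← sq_le_sq]
  have hsq : ‖x - z‖ ^ 2 ≤ ‖y - z‖ ^ 2 := by gcongr
  simp only [EuclideanSpace.real_norm_sq_eq, PiLp.sub_apply] at hsq
  rw [← Finset.add_sum_erase _ _ (Finset.mem_univ i),
    ← Finset.add_sum_erase _ (fun j => (y j - z j) ^ 2) (Finset.mem_univ i)] at hsq
  have hrest : ∑ j ∈ Finset.univ.erase i, (y j - z j) ^ 2 =
      ∑ j ∈ Finset.univ.erase i, (x j - z j) ^ 2 :=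
    Finset.sum_congr rfl fun j hj => by rw [hxy j (Finset.ne_of_mem_erase hj)]
  linarith

/-- A point of `(-∞, a]` at least as close to `c` as `min a c` is equal to `min a c`. -/
theorem eq_min_of_abs_sub_le {a b c : ℝ} (hba : b ≤ a) (h : |b - c| ≤ |min a c - c|) :
    b = min a c := by
  rcases le_total a c with hac | hca
  · rw [min_eq_left hac] at h ⊢
    rw [abs_of_nonpos (by linarith), abs_of_nonpos (by linarith)] at h
    linarith
  · rw [min_eq_right hca] at h ⊢
    rwa [sub_self, abs_zero, abs_nonpos_iff, sub_eq_zero] at h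

/-- Lemma 1 (structure of the projection / relu form): for every `γ` there is a
threshold `ō ≥ 0` such that the Euclidean projection `x = Π_C(γ)` satisfies
`x₁ = ō` and `xᵢ = min(ō, γᵢ)` for every `i = 2, …, n+1`. -/
theorem stmt_1 (n : ℕ) (hn : 1 ≤ n)
    (C : Set (EuclideanSpace ℝ (Fin (n + 1))))
    (hC : C = {x : EuclideanSpace ℝ (Fin (n + 1)) |
      0 ≤ x 0 ∧ ∀ i : Fin (n + 1), i ≠ 0 → x i ≤ x 0})
    (γ x : EuclideanSpace ℝ (Fin (n + 1)))
    (hxC : x ∈ C)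
    (hmin : ∀ y ∈ C, ‖x - γ‖ ≤ ‖y - γ‖) :
    ∃ o : ℝ, 0 ≤ o ∧ x 0 = o ∧ ∀ i : Fin (n + 1), i ≠ 0 → x i = min o (γ i) := by
  subst hC
  obtain ⟨h0, hle⟩ := hxC
  refine ⟨x 0, h0, rfl, fun i hi => eq_min_of_abs_sub_le (hle i hi) ?_⟩
  let y : EuclideanSpace ℝ (Fin (n + 1)) :=
    WithLp.toLp 2 (Function.update (fun j => x j) i (min (x 0) (γ i)))
  have hyi : y i = min (x 0) (γ i) := by simp [y]
  have hyj : ∀ j, j ≠ i → y j = x j := fun j hj => by simp [y, hj]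
  have hy0 : y 0 = x 0 := hyj 0 hi.symm
  rw [← hyi]
  refine EuclideanSpace.abs_apply_sub_le_of_norm_sub_le hyj (hmin y ⟨hy0 ▸ h0, fun j hj => ?_⟩)
  rw [hy0]
  by_cases hji : j = i
  · rw [hji, hyi]
    exact min_le_left _ _
  · rw [hyj j hji]
    exact hle j hj
end

section
/- (Correctness of the sorting-and-averaging projection rule, Lemma 1 / Algorithm 2.) Let γ ∈ ℝ^{n+1} satisfy γ₂ ≥ γ₃ ≥ ⋯ ≥ γ_{n+1}, let k ∈ {1, …, n}, and set ō = (γ₁ + Σ_{i=2}^{k+1} γᵢ)/(k+1). Assume ō ≥ 0, γ_{k+1} ≥ ō, and (in case k < n) γ_{k+2} ≤ ō. Then the Euclidean projection Π_C(γ) is the vector x with x₁ = ō, xᵢ = ō for 2 ≤ i ≤ k+1, and xᵢ = γᵢ for k+2 ≤ i ≤ n+1. -/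
open Finset

theorem Fin.sum_ite_val_lt_one (n k : ℕ) (hk : k ≤ n) :
    ∑ i : Fin n, (if (i : ℕ) < k then (1 : ℝ) else 0) = k := by
  rw [Fin.sum_univ_eq_sum_range (fun i => if i < k then (1 : ℝ) else 0) n, ← Finset.sum_filter,
    show (Finset.range n).filter (· < k) = Finset.range k by ext; simp; omega]
  simp

/-- The residuals of the first `k + 1` coordinates about their mean sum to zero. -/
theorem Fin.sum_ite_mean_sub_eq_zero (n k : ℕ) (hk : k ≤ n) (γ : Fin (n + 1) → ℝ) (o : ℝ)
    (ho : o = (γ 0 + ∑ i ∈ Finset.univ.filter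
        (fun i : Fin (n + 1) => 1 ≤ (i : ℕ) ∧ (i : ℕ) ≤ k), γ i) / (k + 1)) :
    ∑ i : Fin (n + 1), (if (i : ℕ) ≤ k then o - γ i else 0) = 0 := by
  have hmul : o * (k + 1) = γ 0 + ∑ i : Fin n, if (i : ℕ) < k then γ i.succ else 0 := by
    rw [ho, div_mul_cancel₀ _ (by positivity), Finset.sum_filter, Fin.sum_univ_succ]
    simp
  have hone := Fin.sum_ite_val_lt_one n k hk
  have hsplit : ∑ i : Fin n, (if (i : ℕ) < k then o - γ i.succ else 0) =
      o * (∑ i : Fin n, if (i : ℕ) < k then (1 : ℝ) else 0) -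
        ∑ i : Fin n, if (i : ℕ) < k then γ i.succ else 0 := by
    rw [Finset.mul_sum, ← Finset.sum_sub_distrib]
    refine Finset.sum_congr rfl fun i _ => ?_
    split_ifs <;> ring
  rw [Fin.sum_univ_succ]
  simp only [Fin.val_zero, Nat.zero_le, if_true, Fin.val_succ, Nat.succ_le_iff]
  rw [hsplit, hone]
  linarith

/-- Correctness of the sorting-and-averaging projection rule (Lemma 1 / Algorithm 2).
Indices: paper coordinate `i ∈ {1,…,n+1}` corresponds to `Fin (n+1)` index `i-1`;
in particular the sorted coordinates `γ₂ ≥ ⋯ ≥ γ_{n+1}` are indices `1,…,n`, the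
block `{2,…,k+1}` is `{1,…,k}`, `γ_{k+1}` is index `k` and `γ_{k+2}` is index `k+1`. -/
theorem stmt_2 (n : ℕ) (hn : 1 ≤ n)
    (C : Set (EuclideanSpace ℝ (Fin (n + 1))))
    (hC : C = {x : EuclideanSpace ℝ (Fin (n + 1)) |
      0 ≤ x 0 ∧ ∀ i : Fin (n + 1), i ≠ 0 → x i ≤ x 0})
    (γ : EuclideanSpace ℝ (Fin (n + 1)))
    (hsort : ∀ i j : Fin (n + 1), i ≠ 0 → i ≤ j → γ j ≤ γ i)
    (k : ℕ) (hk1 : 1 ≤ k) (hk2 : k ≤ n)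
    (o : ℝ)
    (ho : o = (γ 0 + ∑ i ∈ Finset.univ.filter
        (fun i : Fin (n + 1) => 1 ≤ (i : ℕ) ∧ (i : ℕ) ≤ k), γ i) / (k + 1))
    (ho0 : 0 ≤ o)
    (hko : o ≤ γ ⟨k, by omega⟩)
    (hk2o : ∀ _ : k < n, γ ⟨k + 1, by omega⟩ ≤ o)
    (x : EuclideanSpace ℝ (Fin (n + 1)))
    (hx : ∀ i : Fin (n + 1), x i = if (i : ℕ) ≤ k then o else γ i) :
    x ∈ C ∧ ∀ y ∈ C, ‖x - γ‖ ≤ ‖y - γ‖ := by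
  have hx0 : x 0 = o := by simp [hx]
  have hres := Fin.sum_ite_mean_sub_eq_zero n k hk2 γ o ho
  have hle : ∀ i : Fin (n + 1), i ≠ 0 → (i : ℕ) ≤ k → o ≤ γ i := fun i hi hik =>
    hko.trans (hsort i ⟨k, by omega⟩ hi (Fin.le_def.2 hik))
  subst hC
  refine ⟨⟨hx0.symm ▸ ho0, fun i hi => ?_⟩, ?_⟩
  · rw [hx0, hx]
    split_ifs with hik
    · exact le_rfl
    · have hkn : k < n := by omega
      exact (hsort ⟨k + 1, by omega⟩ i (by simp [Fin.ext_iff])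
        (Fin.le_def.2 (by simp only; omega))).trans (hk2o hkn)
  · rintro y ⟨-, hy⟩
    rw [EuclideanSpace.norm_eq, EuclideanSpace.norm_eq]
    refine Real.sqrt_le_sqrt ?_
    rw [← sub_nonneg, ← Finset.sum_sub_distrib]
    calc (0 : ℝ) = ∑ i : Fin (n + 1),
          2 * (y 0 - o) * (if (i : ℕ) ≤ k then o - γ i else 0) := by
          rw [← Finset.mul_sum, hres, mul_zero]
      _ ≤ _ := Finset.sum_le_sum fun i _ => ?_
    simp only [PiLp.sub_apply, Real.norm_eq_abs, sq_abs, hx]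
    split_ifs with hik
    · rcases eq_or_ne i 0 with rfl | hi
      · nlinarith [sq_nonneg (y 0 - o)]
      · nlinarith [sq_nonneg (y i - o),
          mul_nonneg (sub_nonneg.2 (hy i hi)) (sub_nonneg.2 (hle i hi hik))]
    · nlinarith [sq_nonneg (y i - γ i)]
end

section
/- (KKT sufficiency for the projection QP.) Let γ ∈ ℝ^{n+1}, x ∈ C, and d ∈ ℝ^{n+1} with dᵢ ≥ 0 for all i. Suppose the stationarity conditions xᵢ − γᵢ + dᵢ = 0 for all i = 2, …, n+1 and x₁ − γ₁ − d₁ − Σ_{i=2}^{n+1} dᵢ = 0 hold, together with the complementary slackness conditions dᵢ (xᵢ − x₁) = 0 for i = 2, …, n+1 and d₁ x₁ = 0. Then x = Π_C(γ), i.e., x is the Euclidean projection of γ onto C. -/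
open Finset

/-- KKT sufficiency for the projection QP: if `x ∈ C` and multipliers `d ≥ 0`
satisfy the stationarity and complementary slackness conditions, then `x` is the
Euclidean projection of `γ` onto `C`. -/
theorem stmt_3 (n : ℕ) (hn : 1 ≤ n)
    (C : Set (EuclideanSpace ℝ (Fin (n + 1))))
    (hC : C = {x : EuclideanSpace ℝ (Fin (n + 1)) |
      0 ≤ x 0 ∧ ∀ i : Fin (n + 1), i ≠ 0 → x i ≤ x 0})
    (γ x : EuclideanSpace ℝ (Fin (n + 1)))
    (hxC : x ∈ C)
    (d : Fin (n + 1) → ℝ)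
    (hd : ∀ i, 0 ≤ d i)
    (hstat : ∀ i : Fin (n + 1), i ≠ 0 → x i - γ i + d i = 0)
    (hstat0 : x 0 - γ 0 - d 0 -
      ∑ i ∈ Finset.univ.filter (fun i : Fin (n + 1) => i ≠ 0), d i = 0)
    (hcs : ∀ i : Fin (n + 1), i ≠ 0 → d i * (x i - x 0) = 0)
    (hcs0 : d 0 * x 0 = 0) :
    ∀ y ∈ C, ‖x - γ‖ ≤ ‖y - γ‖ := by
  subst hC
  rintro y ⟨hy0, hy⟩
  have hsum : x 0 - γ 0 = d 0 + ∑ i : Fin n, d i.succ := by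
    have h : ∑ i ∈ Finset.univ.filter (fun i : Fin (n + 1) => i ≠ 0), d i
        = ∑ i : Fin n, d i.succ := by
      rw [Finset.sum_filter, Fin.sum_univ_succ]
      simp [Fin.succ_ne_zero]
    linarith
  have hterm : ∀ i : Fin n, (x i.succ - γ i.succ) ^ 2 - 2 * (d i.succ * (y 0 - x 0))
      ≤ (y i.succ - γ i.succ) ^ 2 := by
    intro i
    have h0 : i.succ ≠ 0 := Fin.succ_ne_zero i
    have hx : x i.succ - γ i.succ = -d i.succ := by linarith [hstat _ h0]
    have hy' : y i.succ - γ i.succ = (y i.succ - x i.succ) - d i.succ := by linarith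
    rw [hx, hy']
    linarith [sq_nonneg (y i.succ - x i.succ), hcs _ h0,
      mul_nonneg (hd i.succ) (sub_nonneg.2 (hy _ h0))]
  have hadd := Finset.sum_le_sum fun i (_ : i ∈ Finset.univ) => hterm i
  rw [Finset.sum_sub_distrib, ← Finset.mul_sum, ← Finset.sum_mul] at hadd
  rw [EuclideanSpace.norm_eq, EuclideanSpace.norm_eq]
  refine Real.sqrt_le_sqrt ?_
  simp only [Fin.sum_univ_succ, PiLp.sub_apply, Real.norm_eq_abs, sq_abs]
  have hy' : y 0 - γ 0 = (y 0 - x 0) + (d 0 + ∑ i : Fin n, d i.succ) := by linarith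
  rw [hsum, hy']
  linarith [sq_nonneg (y 0 - x 0), mul_nonneg (hd 0) hy0]
end

section
/- (The projection raises the first coordinate.) For every γ ∈ ℝ^{n+1}, the first coordinate of the Euclidean projection satisfies (Π_C(γ))₁ ≥ γ₁. -/
/-- The projection raises the first coordinate: `(Π_C(γ))₁ ≥ γ₁`. -/
theorem stmt_4 (n : ℕ) (hn : 1 ≤ n)
    (C : Set (EuclideanSpace ℝ (Fin (n + 1))))
    (hC : C = {x : EuclideanSpace ℝ (Fin (n + 1)) |
      0 ≤ x 0 ∧ ∀ i : Fin (n + 1), i ≠ 0 → x i ≤ x 0})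
    (γ x : EuclideanSpace ℝ (Fin (n + 1)))
    (hxC : x ∈ C)
    (hmin : ∀ y ∈ C, ‖x - γ‖ ≤ ‖y - γ‖) :
    γ 0 ≤ x 0 := by
  subst hC
  obtain ⟨h0, hle⟩ := hxC
  by_contra! hlt
  have hy := hmin (WithLp.toLp 2 (Function.update x.ofLp 0 (γ 0))) <| by
    refine ⟨by simpa using h0.trans hlt.le, fun i hi => ?_⟩
    simpa [hi] using (hle i hi).trans hlt.le
  have hsq := pow_le_pow_left₀ (norm_nonneg _) hy 2
  simp only [EuclideanSpace.real_norm_sq_eq, Fin.sum_univ_succ, PiLp.sub_apply,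
    Function.update_self, Function.update_of_ne (Fin.succ_ne_zero _)] at hsq
  nlinarith [sq_pos_of_pos (sub_pos.mpr hlt)]
end

section
/- (Inactive coordinates are unchanged by the projection.) For every γ ∈ ℝ^{n+1} and every index i ∈ {2, …, n+1}, if (Π_C(γ))ᵢ < (Π_C(γ))₁ then (Π_C(γ))ᵢ = γᵢ. -/
/-- If replacing coordinate `i` of `x` by `c` does not decrease the distance to `γ`, then it does
not decrease the distance in coordinate `i`. -/
theorem EuclideanSpace.sq_sub_le_of_norm_sub_le_update {ι : Type*} [Fintype ι] [DecidableEq ι]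
    (x γ : EuclideanSpace ℝ ι) (i : ι) (c : ℝ)
    (h : ‖x - γ‖ ≤ ‖WithLp.toLp 2 (Function.update x.ofLp i c) - γ‖) :
    (x i - γ i) ^ 2 ≤ (c - γ i) ^ 2 := by
  have hsq := pow_le_pow_left₀ (norm_nonneg _) h 2
  rw [EuclideanSpace.real_norm_sq_eq, EuclideanSpace.real_norm_sq_eq,
    ← Finset.add_sum_erase _ _ (Finset.mem_univ i),
    ← Finset.add_sum_erase _ _ (Finset.mem_univ i)] at hsq
  have hrest : ∑ j ∈ Finset.univ.erase i,
      (WithLp.toLp 2 (Function.update x.ofLp i c) - γ) j ^ 2 =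
      ∑ j ∈ Finset.univ.erase i, (x - γ) j ^ 2 := by
    refine Finset.sum_congr rfl fun j hj => ?_
    simp [Function.update_of_ne (Finset.ne_of_mem_erase hj)]
  rw [hrest] at hsq
  simpa using le_of_add_le_add_right hsq

/-- Inactive coordinates are unchanged by the projection: for `i ∈ {2,…,n+1}`,
if `(Π_C(γ))ᵢ < (Π_C(γ))₁` then `(Π_C(γ))ᵢ = γᵢ`. -/
theorem stmt_5 (n : ℕ) (hn : 1 ≤ n)
    (C : Set (EuclideanSpace ℝ (Fin (n + 1))))
    (hC : C = {x : EuclideanSpace ℝ (Fin (n + 1)) |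
      0 ≤ x 0 ∧ ∀ i : Fin (n + 1), i ≠ 0 → x i ≤ x 0})
    (γ x : EuclideanSpace ℝ (Fin (n + 1)))
    (hxC : x ∈ C)
    (hmin : ∀ y ∈ C, ‖x - γ‖ ≤ ‖y - γ‖)
    (i : Fin (n + 1)) (hi : i ≠ 0)
    (hlt : x i < x 0) :
    x i = γ i := by
  subst hC
  obtain ⟨h0, hle⟩ := hxC
  have key (c : ℝ) (hc : c ≤ x 0) : (x i - γ i) ^ 2 ≤ (c - γ i) ^ 2 := by
    refine EuclideanSpace.sq_sub_le_of_norm_sub_le_update x γ i c (hmin _ ⟨?_, fun j hj => ?_⟩)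
    · simpa [Function.update_of_ne hi.symm] using h0
    · rcases eq_or_ne j i with rfl | hji
      · simpa [Function.update_of_ne hi.symm] using hc
      · simpa [Function.update_of_ne hi.symm, Function.update_of_ne hji] using hle j hj
  rcases le_or_gt (γ i) (x 0) with hγ | hγ
  · nlinarith [key (γ i) hγ]
  · nlinarith [key (x 0) le_rfl]
end

section
/- (Active coordinates are pulled down.) For every γ ∈ ℝ^{n+1} and every index i ∈ {2, …, n+1}, if (Π_C(γ))ᵢ = (Π_C(γ))₁ then γᵢ ≥ (Π_C(γ))₁. -/
/-- Active coordinates are pulled down: for `i ∈ {2,…,n+1}`,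
if `(Π_C(γ))ᵢ = (Π_C(γ))₁` then `γᵢ ≥ (Π_C(γ))₁`. -/
theorem stmt_6 (n : ℕ) (hn : 1 ≤ n)
    (C : Set (EuclideanSpace ℝ (Fin (n + 1))))
    (hC : C = {x : EuclideanSpace ℝ (Fin (n + 1)) |
      0 ≤ x 0 ∧ ∀ i : Fin (n + 1), i ≠ 0 → x i ≤ x 0})
    (γ x : EuclideanSpace ℝ (Fin (n + 1)))
    (hxC : x ∈ C)
    (hmin : ∀ y ∈ C, ‖x - γ‖ ≤ ‖y - γ‖)
    (i : Fin (n + 1)) (hi : i ≠ 0)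
    (heq : x i = x 0) :
    x 0 ≤ γ i := by
  subst hC
  obtain ⟨h0, hle⟩ := hxC
  by_contra! hlt
  let y : EuclideanSpace ℝ (Fin (n + 1)) := WithLp.toLp 2 (Function.update x i (γ i))
  have hyi : y i = γ i := by simp [y]
  have hy : ∀ j, j ≠ i → y j = x j := fun j hj => by simp [y, hj]
  have hyC : 0 ≤ y 0 ∧ ∀ j : Fin (n + 1), j ≠ 0 → y j ≤ y 0 := by
    rw [hy 0 hi.symm]
    refine ⟨h0, fun j hj => ?_⟩
    by_cases hji : j = i
    · rw [hji, hyi]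
      exact hlt.le
    · rw [hy j hji]
      exact hle j hj
  refine (hmin y hyC).not_gt ?_
  rw [EuclideanSpace.norm_eq, EuclideanSpace.norm_eq]
  refine Real.sqrt_lt_sqrt (by positivity) (Finset.sum_lt_sum (fun j _ => ?_)
    ⟨i, Finset.mem_univ i, ?_⟩)
  · by_cases hji : j = i
    · subst hji
      simp only [PiLp.sub_apply, hyi, sub_self, norm_zero, zero_pow two_ne_zero]
      positivity
    · simp only [PiLp.sub_apply, hy j hji, le_refl]
  · simp only [PiLp.sub_apply, hyi, sub_self, norm_zero, zero_pow two_ne_zero]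
    have : x i - γ i ≠ 0 := sub_ne_zero.mpr (heq ▸ hlt.ne')
    positivity
end

section
/- (Characterization of the active set.) For every γ ∈ ℝ^{n+1}, the active set I := {i ∈ {2, …, n+1} : (Π_C(γ))ᵢ = (Π_C(γ))₁} equals the super-level set {i ∈ {2, …, n+1} : γᵢ ≥ (Π_C(γ))₁}. -/
/-- A point `x` at least as close to `γ` as its shift by `s` along a coordinate axis satisfies the
corresponding one-variable quadratic inequality. -/
theorem EuclideanSpace.quadratic_nonneg_of_norm_sub_le_add_single {ι : Type*} [Fintype ι]
    [DecidableEq ι] {γ x : EuclideanSpace ℝ ι} {i : ι} {s : ℝ}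
    (h : ‖x - γ‖ ≤ ‖x + EuclideanSpace.single i s - γ‖) :
    0 ≤ 2 * s * (x i - γ i) + s ^ 2 := by
  have hsq := pow_le_pow_left₀ (norm_nonneg _) h 2
  rw [add_sub_right_comm, norm_add_sq_real, EuclideanSpace.inner_single_right,
    PiLp.norm_single, Real.norm_eq_abs, sq_abs] at hsq
  simp only [PiLp.sub_apply, conj_trivial] at hsq
  linarith

/-- Characterization of the active set: the set of indices `i ∈ {2,…,n+1}` with
`(Π_C(γ))ᵢ = (Π_C(γ))₁` equals the super-level set `{i : γᵢ ≥ (Π_C(γ))₁}`. -/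
theorem stmt_7 (n : ℕ) (hn : 1 ≤ n)
    (C : Set (EuclideanSpace ℝ (Fin (n + 1))))
    (hC : C = {x : EuclideanSpace ℝ (Fin (n + 1)) |
      0 ≤ x 0 ∧ ∀ i : Fin (n + 1), i ≠ 0 → x i ≤ x 0})
    (γ x : EuclideanSpace ℝ (Fin (n + 1)))
    (hxC : x ∈ C)
    (hmin : ∀ y ∈ C, ‖x - γ‖ ≤ ‖y - γ‖) :
    {i : Fin (n + 1) | i ≠ 0 ∧ x i = x 0} =
      {i : Fin (n + 1) | i ≠ 0 ∧ x 0 ≤ γ i} := by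
  subst hC
  obtain ⟨h0, hle⟩ := hxC
  have key (i : Fin (n + 1)) (hi : i ≠ 0) (s : ℝ) (hs : x i + s ≤ x 0) :
      0 ≤ 2 * s * (x i - γ i) + s ^ 2 := by
    refine EuclideanSpace.quadratic_nonneg_of_norm_sub_le_add_single (hmin _ ⟨?_, fun j hj => ?_⟩)
    · simpa [hi.symm] using h0
    · by_cases hji : j = i
      · subst hji
        simpa [hi.symm] using hs
      · simpa [hi.symm, hji] using hle j hj
  ext i
  refine and_congr_right fun hi => ⟨fun hx => ?_, fun hγ => ?_⟩
  · by_contra! hlt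
    nlinarith [key i hi (γ i - x i) (by linarith)]
  · refine (hle i hi).antisymm ?_
    by_contra! hlt
    nlinarith [key i hi (x 0 - x i) (by linarith)]
end

section
/- (The active set is a prefix under sorting.) Let γ ∈ ℝ^{n+1} satisfy γ₂ ≥ γ₃ ≥ ⋯ ≥ γ_{n+1}. Then there exists k ∈ {0, 1, …, n} such that the Euclidean projection x = Π_C(γ) satisfies xᵢ = x₁ for all 2 ≤ i ≤ k+1 and xᵢ = γᵢ for all k+2 ≤ i ≤ n+1. -/
/-- Changing one coordinate without decreasing the distance to `γ` does not decrease the distance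
in that coordinate. -/
theorem EuclideanSpace.sq_sub_le_sq_sub_of_norm_update {ι : Type*} [Fintype ι] [DecidableEq ι]
    {x γ : EuclideanSpace ℝ ι} {i : ι} {t : ℝ}
    (h : ‖x - γ‖ ≤ ‖WithLp.toLp 2 (Function.update x i t) - γ‖) :
    (x i - γ i) ^ 2 ≤ (t - γ i) ^ 2 := by
  have h2 := pow_le_pow_left₀ (norm_nonneg _) h 2
  rw [EuclideanSpace.real_norm_sq_eq, EuclideanSpace.real_norm_sq_eq,
    ← Finset.add_sum_erase _ _ (Finset.mem_univ i),
    ← Finset.add_sum_erase _ _ (Finset.mem_univ i)] at h2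
  have hrest : ∑ j ∈ Finset.univ.erase i,
      ((WithLp.toLp 2 (Function.update x i t) - γ : EuclideanSpace ℝ ι) j) ^ 2 =
      ∑ j ∈ Finset.univ.erase i, ((x - γ) j) ^ 2 := by
    refine Finset.sum_congr rfl fun j hj => ?_
    simp [Function.update_of_ne (Finset.ne_of_mem_erase hj)]
  rw [hrest] at h2
  simpa using le_of_add_le_add_right h2

/-- A minimizer of the distance to `γ` over the cone `0 ≤ x 0`, `x i ≤ x 0` truncates every
coordinate `i ≠ 0` of `γ` at the level `x 0`. -/
theorem EuclideanSpace.apply_eq_min_of_norm_sub_le {n : ℕ}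
    {γ x : EuclideanSpace ℝ (Fin (n + 1))}
    (h0 : 0 ≤ x 0) (hle : ∀ i : Fin (n + 1), i ≠ 0 → x i ≤ x 0)
    (hmin : ∀ y : EuclideanSpace ℝ (Fin (n + 1)),
      0 ≤ y 0 → (∀ i : Fin (n + 1), i ≠ 0 → y i ≤ y 0) → ‖x - γ‖ ≤ ‖y - γ‖)
    {i : Fin (n + 1)} (hi : i ≠ 0) : x i = min (γ i) (x 0) := by
  have key : (x i - γ i) ^ 2 ≤ (min (γ i) (x 0) - γ i) ^ 2 := by
    refine sq_sub_le_sq_sub_of_norm_update (hmin _ ?_ fun j hj => ?_)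
    · simpa [Function.update_of_ne hi.symm] using h0
    · rcases eq_or_ne j i with rfl | hji
      · simp [Function.update_of_ne hi.symm]
      · simpa [Function.update_of_ne hi.symm, Function.update_of_ne hji] using hle j hj
  have hxi := hle i hi
  rcases le_total (γ i) (x 0) with h | h
  · rw [min_eq_left h] at key ⊢
    nlinarith [sq_nonneg (x i - γ i)]
  · rw [min_eq_right h] at key ⊢
    nlinarith [sq_nonneg (x i - x 0)]

/-- The active set is a prefix under sorting: if `γ₂ ≥ ⋯ ≥ γ_{n+1}` (coordinates
`1,…,n` of `Fin (n+1)`), then there is `k ∈ {0,…,n}` such that the projection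
`x = Π_C(γ)` satisfies `xᵢ = x₁` for the first `k` sorted coordinates (paper
indices `2 ≤ i ≤ k+1`, i.e. `Fin` indices `1,…,k`) and `xᵢ = γᵢ` for the rest
(paper indices `k+2 ≤ i ≤ n+1`, i.e. `Fin` indices `≥ k+1`). -/
theorem stmt_8 (n : ℕ) (hn : 1 ≤ n)
    (C : Set (EuclideanSpace ℝ (Fin (n + 1))))
    (hC : C = {x : EuclideanSpace ℝ (Fin (n + 1)) |
      0 ≤ x 0 ∧ ∀ i : Fin (n + 1), i ≠ 0 → x i ≤ x 0})
    (γ x : EuclideanSpace ℝ (Fin (n + 1)))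
    (hsort : ∀ i j : Fin (n + 1), i ≠ 0 → i ≤ j → γ j ≤ γ i)
    (hxC : x ∈ C)
    (hmin : ∀ y ∈ C, ‖x - γ‖ ≤ ‖y - γ‖) :
    ∃ k : ℕ, k ≤ n ∧
      (∀ i : Fin (n + 1), 1 ≤ (i : ℕ) → (i : ℕ) ≤ k → x i = x 0) ∧
      (∀ i : Fin (n + 1), k + 1 ≤ (i : ℕ) → x i = γ i) := by
  subst hC
  have hmineq : ∀ i : Fin (n + 1), i ≠ 0 → x i = min (γ i) (x 0) := fun i hi =>
    EuclideanSpace.apply_eq_min_of_norm_sub_le hxC.1 hxC.2 (fun y h1 h2 => hmin y ⟨h1, h2⟩) hi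
  classical
  let P : ℕ → Prop := fun k => ∀ i : Fin (n + 1), 1 ≤ (i : ℕ) → (i : ℕ) ≤ k → x 0 ≤ γ i
  have hP : P (Nat.findGreatest P n) :=
    Nat.findGreatest_spec (Nat.zero_le n) fun i h1 h2 => by omega
  have hne : ∀ i : Fin (n + 1), 1 ≤ (i : ℕ) → i ≠ 0 := by
    rintro i h1 rfl
    simp at h1
  refine ⟨Nat.findGreatest P n, Nat.findGreatest_le n, fun i h1 h2 => ?_, fun i h => ?_⟩
  · rw [hmineq i (hne i h1), min_eq_right (hP i h1 h2)]
  · rw [hmineq i (hne i (by omega)), min_eq_left]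
    by_contra! hlt
    have : (i : ℕ) ≤ Nat.findGreatest P n :=
      Nat.le_findGreatest (by omega) fun j h1 h2 =>
        hlt.le.trans (hsort j i (hne j h1) (Fin.le_def.mpr h2))
    omega
end

section
/- (The threshold is the clamped average over the active block.) For every γ ∈ ℝ^{n+1}, letting I := {i ∈ {2, …, n+1} : (Π_C(γ))ᵢ = (Π_C(γ))₁} be the active set, the first coordinate of the projection satisfies (Π_C(γ))₁ = max(0, (γ₁ + Σ_{i∈I} γᵢ)/(|I| + 1)). -/
open Finset

/-- First-order condition for a nearest point: the displacement `x - γ` has nonnegative inner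
product with every direction that stays feasible for small positive steps. -/
theorem inner_nonneg_of_eventually_feasible {E : Type*} [NormedAddCommGroup E]
    [InnerProductSpace ℝ E] {C : Set E} {γ x d : E} (hmin : ∀ y ∈ C, ‖x - γ‖ ≤ ‖y - γ‖)
    (hd : ∀ᶠ t : ℝ in nhdsWithin 0 (Set.Ioi 0), x + t • d ∈ C) :
    0 ≤ inner ℝ (x - γ) d := by
  have hlim : Filter.Tendsto (fun t : ℝ => 2 * inner ℝ (x - γ) d + t * ‖d‖ ^ 2)
      (nhdsWithin 0 (Set.Ioi 0)) (nhds (2 * inner ℝ (x - γ) d + 0 * ‖d‖ ^ 2)) :=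
    (Continuous.tendsto (by fun_prop) 0).mono_left nhdsWithin_le_nhds
  have hev : ∀ᶠ t : ℝ in nhdsWithin 0 (Set.Ioi 0),
      0 ≤ 2 * inner ℝ (x - γ) d + t * ‖d‖ ^ 2 := by
    filter_upwards [hd, self_mem_nhdsWithin] with t ht htpos
    have htpos : 0 < t := htpos
    have hle := pow_le_pow_left₀ (norm_nonneg _) (hmin _ ht) 2
    rw [add_sub_right_comm, norm_add_sq_real, inner_smul_right, norm_smul, mul_pow,
      Real.norm_eq_abs, sq_abs] at hle
    refine nonneg_of_mul_nonneg_right (a := t) ?_ htpos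
    linarith
  have := ge_of_tendsto hlim hev
  linarith

/-- The threshold is the clamped average over the active block:
`(Π_C(γ))₁ = max(0, (γ₁ + Σ_{i∈I} γᵢ)/(|I|+1))` where `I` is the active set. -/
theorem stmt_9 (n : ℕ) (hn : 1 ≤ n)
    (C : Set (EuclideanSpace ℝ (Fin (n + 1))))
    (hC : C = {x : EuclideanSpace ℝ (Fin (n + 1)) |
      0 ≤ x 0 ∧ ∀ i : Fin (n + 1), i ≠ 0 → x i ≤ x 0})
    (γ x : EuclideanSpace ℝ (Fin (n + 1)))
    (hxC : x ∈ C)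
    (hmin : ∀ y ∈ C, ‖x - γ‖ ≤ ‖y - γ‖)
    (I : Finset (Fin (n + 1)))
    (hI : ∀ i : Fin (n + 1), i ∈ I ↔ (i ≠ 0 ∧ x i = x 0)) :
    x 0 = max 0 ((γ 0 + ∑ i ∈ I, γ i) / (I.card + 1)) := by
  subst hC
  obtain ⟨hx0, hxi⟩ := hxC
  let e : EuclideanSpace ℝ (Fin (n + 1)) :=
    WithLp.toLp 2 (fun i => if i ∈ insert 0 I then 1 else 0)
  have he_apply : ∀ i, e i = if i ∈ insert 0 I then 1 else 0 := fun i => rfl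
  have he0 : e 0 = 1 := by simp [he_apply]
  have h0I : (0 : Fin (n + 1)) ∉ I := fun h => ((hI 0).1 h).1 rfl
  have hinner : inner ℝ (x - γ) e = (I.card + 1) * x 0 - (γ 0 + ∑ i ∈ I, γ i) := by
    have hsum : ∑ i ∈ I, x i = I.card * x 0 := by
      rw [Finset.sum_congr rfl fun i hi => ((hI i).1 hi).2, Finset.sum_const, nsmul_eq_mul]
    have : inner ℝ (x - γ) e = ∑ i ∈ insert 0 I, (x i - γ i) := by
      simp only [PiLp.inner_apply, he_apply, RCLike.inner_apply, conj_trivial, PiLp.sub_apply,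
        ite_mul, one_mul, zero_mul, Finset.sum_ite_mem, Finset.univ_inter]
    rw [this, Finset.sum_insert h0I, Finset.sum_sub_distrib, hsum]
    ring
  have hcard : (0 : ℝ) < I.card + 1 := by positivity
  have hup : 0 ≤ inner ℝ (x - γ) e := by
    refine inner_nonneg_of_eventually_feasible hmin ?_
    filter_upwards [self_mem_nhdsWithin] with t ht
    have ht : 0 < t := ht
    refine ⟨?_, fun i hi => ?_⟩
    · simp only [PiLp.add_apply, PiLp.smul_apply, smul_eq_mul, he0]
      linarith
    · have := hxi i hi
      simp only [PiLp.add_apply, PiLp.smul_apply, smul_eq_mul, he0, he_apply i]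
      split_ifs <;> linarith
  rcases hx0.eq_or_lt with h0 | hpos
  · rw [← h0, eq_comm, max_eq_left]
    rw [hinner, ← h0] at hup
    exact div_nonpos_of_nonpos_of_nonneg (by linarith) hcard.le
  · have hdown : 0 ≤ inner ℝ (x - γ) (-e) := by
      refine inner_nonneg_of_eventually_feasible hmin ?_
      have hsmall : ∀ a : ℝ, 0 < a → ∀ᶠ t : ℝ in nhdsWithin 0 (Set.Ioi 0), t < a :=
        fun a ha => nhdsWithin_le_nhds (eventually_lt_nhds ha)
      have hall : ∀ᶠ t : ℝ in nhdsWithin 0 (Set.Ioi 0), ∀ i, x i < x 0 → t < x 0 - x i := by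
        refine Filter.eventually_all.2 fun i => ?_
        by_cases h : x i < x 0
        · filter_upwards [hsmall _ (sub_pos.2 h)] with t ht _ using ht
        · exact Filter.Eventually.of_forall fun t h' => absurd h' h
      filter_upwards [hsmall _ hpos, hall] with t ht hti
      refine ⟨?_, fun i hi => ?_⟩
      · simp only [PiLp.add_apply, PiLp.smul_apply, PiLp.neg_apply, smul_eq_mul, he0]
        linarith
      · have hle := hxi i hi
        simp only [PiLp.add_apply, PiLp.smul_apply, PiLp.neg_apply, smul_eq_mul, he0, he_apply i]
        split_ifs with hmem
        · linarith
        · have hne : x i ≠ x 0 := fun h => hmem (Finset.mem_insert_of_mem ((hI i).2 ⟨hi, h⟩))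
          linarith [hti i (lt_of_le_of_ne hle hne)]
    rw [inner_neg_right] at hdown
    have havg : x 0 = (γ 0 + ∑ i ∈ I, γ i) / (I.card + 1) := by
      rw [eq_div_iff hcard.ne']
      linarith
    rw [← havg, max_eq_right hx0]
end

section
/- (Relu representation of the projection, Observation on backpropagation.) Let γ ∈ ℝ^{n+1} and let ō = (Π_C(γ))₁ be the first coordinate of the Euclidean projection of γ onto C. Then for every i ∈ {2, …, n+1}, (Π_C(γ))ᵢ = min(ō, γᵢ) = −max(−ō, −γᵢ); that is, on the coordinates 2, …, n+1 the projection is the componentwise minimum with the threshold ō and hence is computable by a rectified-linear (relu) operation. -/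
/-- If replacing one coordinate of `x` does not decrease the distance to `γ`, then it does not
decrease the distance in that coordinate. -/
theorem EuclideanSpace.abs_sub_le_of_norm_sub_le_norm_update_sub {ι : Type*} [Fintype ι]
    [DecidableEq ι] {x γ : EuclideanSpace ℝ ι} {i : ι} {t : ℝ}
    (h : ‖x - γ‖ ≤ ‖WithLp.toLp 2 (Function.update x.ofLp i t) - γ‖) :
    |x i - γ i| ≤ |t - γ i| := by
  have hsq := pow_le_pow_left₀ (norm_nonneg _) h 2
  rw [EuclideanSpace.norm_sq_eq, EuclideanSpace.norm_sq_eq,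
    ← Finset.add_sum_erase _ _ (Finset.mem_univ i),
    ← Finset.add_sum_erase _ _ (Finset.mem_univ i)] at hsq
  have hrest : ∑ j ∈ Finset.univ.erase i,
        ‖(WithLp.toLp 2 (Function.update x.ofLp i t) - γ) j‖ ^ 2 =
      ∑ j ∈ Finset.univ.erase i, ‖(x - γ) j‖ ^ 2 :=
    Finset.sum_congr rfl fun j hj => by simp [Finset.ne_of_mem_erase hj]
  rw [hrest, add_le_add_iff_right] at hsq
  exact sq_le_sq.mp (by simpa using hsq)


/-- Relu representation of the projection: with `ō = (Π_C(γ))₁`, for every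
`i ∈ {2,…,n+1}` one has `(Π_C(γ))ᵢ = min(ō, γᵢ) = −max(−ō, −γᵢ)`. -/
theorem stmt_16 (n : ℕ) (hn : 1 ≤ n)
    (C : Set (EuclideanSpace ℝ (Fin (n + 1))))
    (hC : C = {x : EuclideanSpace ℝ (Fin (n + 1)) |
      0 ≤ x 0 ∧ ∀ i : Fin (n + 1), i ≠ 0 → x i ≤ x 0})
    (γ x : EuclideanSpace ℝ (Fin (n + 1)))
    (hxC : x ∈ C)
    (hmin : ∀ y ∈ C, ‖x - γ‖ ≤ ‖y - γ‖)
    (o : ℝ) (ho : o = x 0) :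
    ∀ i : Fin (n + 1), i ≠ 0 →
      x i = min o (γ i) ∧ x i = -max (-o) (-(γ i)) := by
  intro i hi
  subst hC ho
  obtain ⟨hx0, hx⟩ := hxC
  have hle := EuclideanSpace.abs_sub_le_of_norm_sub_le_norm_update_sub
    (hmin (WithLp.toLp 2 (Function.update x.ofLp i (min (x 0) (γ i)))) (by
      refine ⟨by simpa [hi.symm] using hx0, fun j hj => ?_⟩
      rcases eq_or_ne j i with rfl | hji
      · simp [hi.symm]
      · simpa [hi.symm, hji] using hx j hj))
  have key : x i = min (x 0) (γ i) := by
    have hxi := hx i hi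
    rcases le_total (x 0) (γ i) with h | h
    · rw [min_eq_left h, abs_of_nonpos (by linarith), abs_of_nonpos (by linarith)] at hle
      rw [min_eq_left h]
      linarith
    · rw [min_eq_right h, sub_self, abs_zero] at hle
      rw [min_eq_right h]
      exact sub_eq_zero.mp (abs_nonpos_iff.mp hle)
  exact ⟨key, by rw [max_neg_neg, neg_neg, key]⟩
end

section
/- (Monotone ordering of projected coordinates.) For every γ ∈ ℝ^{n+1} and all indices i, j ∈ {2, …, n+1}, if γᵢ ≥ γⱼ then (Π_C(γ))ᵢ ≥ (Π_C(γ))ⱼ; that is, the Euclidean projection onto C preserves the ordering of the coordinates 2, …, n+1. -/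
/-- Monotone ordering of projected coordinates: the Euclidean projection onto
`C` preserves the ordering of the coordinates `2,…,n+1`. -/
theorem stmt_19 (n : ℕ) (hn : 1 ≤ n)
    (C : Set (EuclideanSpace ℝ (Fin (n + 1))))
    (hC : C = {x : EuclideanSpace ℝ (Fin (n + 1)) |
      0 ≤ x 0 ∧ ∀ i : Fin (n + 1), i ≠ 0 → x i ≤ x 0})
    (γ x : EuclideanSpace ℝ (Fin (n + 1)))
    (hxC : x ∈ C)
    (hmin : ∀ y ∈ C, ‖x - γ‖ ≤ ‖y - γ‖)
    (i j : Fin (n + 1)) (hi : i ≠ 0) (hj : j ≠ 0)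
    (hij : γ j ≤ γ i) :
    x j ≤ x i := by
  by_contra! hlt
  subst hC
  obtain ⟨h0, hle⟩ := hxC
  have hne : i ≠ j := by rintro rfl; exact lt_irrefl _ hlt
  -- Averaging the coordinates `i` and `j` gives a strictly closer point of `C`.
  obtain ⟨d, hd⟩ : ∃ d : ℝ, d = (x j - x i) / 2 := ⟨_, rfl⟩
  have hdpos : 0 < d := by linarith
  set v : EuclideanSpace ℝ (Fin (n + 1)) :=
    EuclideanSpace.single i d - EuclideanSpace.single j d with hv
  have hvk : ∀ k, v k = (if k = i then d else 0) - (if k = j then d else 0) := by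
    intro k
    simp [hv]
  have hmem := hmin (x + v) ⟨by simpa [hvk, hi.symm, hj.symm] using h0, by
    intro k hk
    have h₁ := hle k hk
    have h₂ := hle j hj
    simp only [PiLp.add_apply, hvk, hi.symm, hj.symm, if_false]
    by_cases hki : k = i
    · subst hki
      simp only [hne, if_true, if_false]
      linarith
    · simp only [hki, if_false]
      split_ifs <;> linarith⟩
  have hsq : ‖x - γ‖ ^ 2 ≤ ‖(x - γ) + v‖ ^ 2 := by
    rw [show (x - γ) + v = x + v - γ by abel]
    gcongr
  have hinner (w : EuclideanSpace ℝ (Fin (n + 1))) : inner ℝ w v = d * (w i - w j) := by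
    simp only [hv, inner_sub_right, EuclideanSpace.inner_single_right, conj_trivial]
    ring
  rw [norm_add_sq_real, ← real_inner_self_eq_norm_sq v, hinner, hinner, hvk, hvk] at hsq
  simp only [PiLp.sub_apply, hne, hne.symm, if_true, if_false] at hsq
  nlinarith [mul_nonneg hdpos.le (sub_nonneg.2 hij), mul_pos hdpos hdpos]
end
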